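/- arXiv:1104.2072 — 3 statements merged into one kernel-verified Lean document; each statement's English description precedes it below -/
import Mathlib

section
/- Let k be a solid assignment. Then for every B ∈ 𝔹_k the homogeneous polynomial p_{X′(B)} belongs to 𝒫_k, and the family of polynomials (p_{X′(B)})_{B ∈ 𝔹_k} is linearly independent. -/
open MvPolynomial

noncomputable section

/-- The linear polynomial `p_x : t ↦ x ⬝ t`. -/
def pLin (n : ℕ) (x : Fin n → ℝ) : MvPolynomial (Fin n) ℝ :=
  ∑ i, MvPolynomial.C (x i) * MvPolynomial.X i

/-- `p_Z = ∏_{x ∈ Z} p_x` for a sub-multiset `Z` of the multiset indexed by `ι`. -/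
def pProd (n : ℕ) {ι : Type} (v : ι → Fin n → ℝ) (Z : Finset ι) : MvPolynomial (Fin n) ℝ :=
  ∏ a ∈ Z, pLin n (v a)

/-- `q_Z = ∏_{x ∈ Z} (p_x - λ_x)`. -/
def qProd (n : ℕ) {ι : Type} (v : ι → Fin n → ℝ) (lam : ι → ℝ) (Z : Finset ι) :
    MvPolynomial (Fin n) ℝ :=
  ∏ a ∈ Z, (pLin n (v a) - MvPolynomial.C (lam a))

/-- The pairing `⟨p,q⟩ = (p(∂)q)(0) = ∑_α α! p_α q_α`. -/
def pairing (n : ℕ) (p q : MvPolynomial (Fin n) ℝ) : ℝ :=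
  ∑ α ∈ p.support, p.coeff α * q.coeff α * (α.prod fun _ e => (Nat.factorial e : ℝ))

/-- `B` is a basis of the multiset: its vectors form a basis of `ℝ^n`. -/
def IsBasisSet (n : ℕ) {ι : Type} (v : ι → Fin n → ℝ) (B : Finset ι) : Prop :=
  LinearIndependent ℝ (fun b : B => v b) ∧ Submodule.span ℝ (v '' ↑B) = ⊤

/-- The ideal `𝒥_{𝔹'}` generated by the `p_Z` over all `Z` meeting every `B ∈ 𝔹'`. -/
def Jideal (n : ℕ) {ι : Type} [DecidableEq ι] (v : ι → Fin n → ℝ) (𝔹' : Set (Finset ι)) :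
    Ideal (MvPolynomial (Fin n) ℝ) :=
  Ideal.span {p | ∃ Z : Finset ι, (∀ B ∈ 𝔹', (Z ∩ B).Nonempty) ∧ p = pProd n v Z}

/-- The kernel space `𝒟_{𝔹'}`. -/
def Dspace (n : ℕ) {ι : Type} [DecidableEq ι] (v : ι → Fin n → ℝ) (𝔹' : Set (Finset ι)) :
    Submodule ℝ (MvPolynomial (Fin n) ℝ) where
  carrier := {f | ∀ g ∈ Jideal n v 𝔹', pairing n g f = 0}
  zero_mem' := by intro g _; simp [pairing]
  add_mem' := by
    intro a b ha hb g hg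
    have h : pairing n g (a + b) = pairing n g a + pairing n g b := by
      simp only [pairing, MvPolynomial.coeff_add]
      rw [← Finset.sum_add_distrib]
      exact Finset.sum_congr rfl fun α _ => by ring
    rw [h, ha g hg, hb g hg, add_zero]
  smul_mem' := by
    intro c f hf g hg
    have h : pairing n g (c • f) = c * pairing n g f := by
      simp only [pairing, MvPolynomial.coeff_smul, smul_eq_mul, Finset.mul_sum]
      exact Finset.sum_congr rfl fun α _ => by ring
    rw [h, hf g hg, mul_zero]

/-- A solid assignment `k : 2^X → ℕ`. -/
def Solid (n : ℕ) {ι : Type} (v : ι → Fin n → ℝ) (k : Finset ι → ℕ) : Prop :=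
  ∀ Z Z' : Finset ι,
    Submodule.span ℝ (v '' ↑Z) ≤ Submodule.span ℝ (v '' ↑Z') → k Z ≤ k Z'

/-- An incremental assignment. -/
def Incremental {ι : Type} [DecidableEq ι] (k : Finset ι → ℕ) : Prop :=
  ∀ (Z : Finset ι) (x : ι), k (insert x Z) ≤ k Z + 1

/-- `m(I) = k(I) + n - #I`. -/
def mVal (n : ℕ) {ι : Type} (k : Finset ι → ℕ) (I : Finset ι) : ℕ := k I + n - I.card

/-- `B ∩ X` for `B ⊆ X ∪ Y`. -/
def leftPart {ι : Type} [Fintype ι] [DecidableEq ι] {M : ℕ} (B : Finset (ι ⊕ Fin M)) :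
    Finset ι :=
  Finset.univ.filter fun i => Sum.inl i ∈ B

/-- `B ∩ Y` for `B ⊆ X ∪ Y`, as a set of indices in `Y`. -/
def rightPart {ι : Type} [Fintype ι] [DecidableEq ι] {M : ℕ} (B : Finset (ι ⊕ Fin M)) :
    Finset (Fin M) :=
  Finset.univ.filter fun j => Sum.inr j ∈ B

/-- `Y_i = {y_1, …, y_i}` as a set of indices. -/
def YFin {M : ℕ} (i : ℕ) : Finset (Fin M) := Finset.univ.filter fun j => (j : ℕ) < i

/-- `X ∪ Y_i` as a subset of the index set of `X ∪ Y`. -/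
def XYup (ι : Type) [Fintype ι] [DecidableEq ι] (M : ℕ) (i : ℕ) : Finset (ι ⊕ Fin M) :=
  Finset.univ.image Sum.inl ∪ (YFin (M := M) i).image Sum.inr

/-- `Y` is in general position in `X ∪ Y`: no `y ∈ Y` lies in the span of fewer than `n`
vectors of `(X ∪ Y) ∖ {y}`. -/
def GeneralPosition (n : ℕ) {ι : Type} [Fintype ι] [DecidableEq ι] {M : ℕ}
    (v : ι → Fin n → ℝ) (y : Fin M → Fin n → ℝ) : Prop :=
  ∀ (j : Fin M) (S : Finset (ι ⊕ Fin M)), Sum.inr j ∉ S → S.card < n →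
    y j ∉ Submodule.span ℝ (Sum.elim v y '' ↑S)

/-- `𝔹_k : the bases `B` of `X ∪ Y` with `B ∩ Y ⊆ Y_{m(B ∩ X)}`. -/
def Bk (n : ℕ) {ι : Type} [Fintype ι] [DecidableEq ι] (v : ι → Fin n → ℝ) {M : ℕ}
    (y : Fin M → Fin n → ℝ) (k : Finset ι → ℕ) : Set (Finset (ι ⊕ Fin M)) :=
  {B | IsBasisSet n (Sum.elim v y) B ∧
    ∀ j : Fin M, Sum.inr j ∈ B → (j : ℕ) < mVal n k (leftPart B)}

/-- The space `𝒫_k = ∑_{Z ⊆ X} p_{X∖Z} Π_{k(Z)}`. -/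
def Pspace (n : ℕ) {ι : Type} [Fintype ι] [DecidableEq ι] (v : ι → Fin n → ℝ)
    (k : Finset ι → ℕ) : Submodule ℝ (MvPolynomial (Fin n) ℝ) :=
  ⨆ Z : Finset ι,
    Submodule.map (LinearMap.mulLeft ℝ (pProd n v (Finset.univ \ Z)))
      (MvPolynomial.restrictTotalDegree (Fin n) ℝ (k Z))

/-- The constants `λ` are generic: each basis `B` determines a point `bp B` at which
`q_z` vanishes exactly when `z ∈ B`. -/
def Generic (n : ℕ) {ι : Type} (v : ι → Fin n → ℝ) (lam : ι → ℝ)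
    (bp : Finset ι → Fin n → ℝ) : Prop :=
  ∀ B : Finset ι, IsBasisSet n v B →
    ∀ z : ι, MvPolynomial.eval (bp B) (pLin n (v z) - MvPolynomial.C (lam z)) = 0 ↔ z ∈ B

/-- `x` is placable in `𝔹'`. -/
def Placable {ι : Type} [DecidableEq ι] (x : ι) (𝔹' : Set (Finset ι)) : Prop :=
  ∀ B ∈ 𝔹', ∃ a ∈ B, (insert x B).erase a ∈ 𝔹'

/-- `𝔹'` is placible. -/
inductive Placible {ι : Type} [DecidableEq ι] : Set (Finset ι) → Prop
  | singleton (B : Finset ι) : Placible {B}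
  | split (𝔹' : Set (Finset ι)) (x : ι) (hx : Placable x 𝔹')
      (hne1 : {B ∈ 𝔹' | x ∈ B}.Nonempty) (hne2 : {B ∈ 𝔹' | x ∉ B}.Nonempty)
      (hp1 : Placible {B ∈ 𝔹' | x ∈ B}) (hp2 : Placible {B ∈ 𝔹' | x ∉ B}) :
      Placible 𝔹'

/-- `X(I)` : the elements of `X ∖ I` not in the span of the earlier elements of `I`. -/
def XsetI (n : ℕ) {ι : Type} [Fintype ι] [DecidableEq ι] [LinearOrder ι]
    (v : ι → Fin n → ℝ) (I : Finset ι) : Finset ι := by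
  classical
  exact Finset.univ.filter fun x =>
    x ∉ I ∧ v x ∉ Submodule.span ℝ (v '' {b | b ∈ I ∧ b < x})

/-- `X'(B)` for `B ⊆ X ∪ Y`, with the order on `X ∪ Y` putting `X` (with its own order)
before `Y` (ordered as given). -/
def XprimeB (n : ℕ) {ι : Type} [Fintype ι] [DecidableEq ι] [LinearOrder ι] {M : ℕ}
    (v : ι → Fin n → ℝ) (y : Fin M → Fin n → ℝ) (B : Finset (ι ⊕ Fin M)) :
    Finset (ι ⊕ Fin M) := by
  classical
  exact Finset.univ.filter fun z =>
    z ∉ B ∧ Sum.elim v y z ∉ Submodule.span ℝ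
      (Sum.elim v y '' {b | b ∈ B ∧ Sum.Lex (· < ·) (· < ·) b z})

/-- The least space `Π(Θ)`. -/
def leastSpace (n : ℕ) (Θ : Finset (Fin n → ℝ)) : Submodule ℝ (MvPolynomial (Fin n) ℝ) :=
  Submodule.span ℝ
    {f | ∃ (c : (Fin n → ℝ) → ℝ) (J : ℕ),
      f = (Nat.factorial J : ℝ)⁻¹ • ∑ θ ∈ Θ, c θ • pLin n θ ^ J ∧ f ≠ 0 ∧
      ∀ j < J, ∑ θ ∈ Θ, c θ • pLin n θ ^ j = 0}

/-- The central space `𝒫(X)`, spanned by the `p_Z` over short `Z`. -/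
def centralP (n : ℕ) {ι : Type} [Fintype ι] [DecidableEq ι] (v : ι → Fin n → ℝ) :
    Submodule ℝ (MvPolynomial (Fin n) ℝ) :=
  Submodule.span ℝ
    {p | ∃ Z : Finset ι, Submodule.span ℝ (v '' ↑(Finset.univ \ Z)) = ⊤ ∧ p = pProd n v Z}

end

lemma s7_key {V α : Type*} [AddCommGroup V] [Module ℝ V] [LinearOrder α] (w : α → V)
    (S : Finset α) : ∀ (U : Submodule ℝ V) (F : Finset (Finset α)) (c : Finset α → ℝ)
    (Q : Finset α → Finset α)
    (_ : ∀ B ∈ F, ∀ z, z ∈ Q B ↔ z ∈ S ∧ z ∉ B ∧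
      w z ∉ U ⊔ Submodule.span ℝ (w '' {b | b ∈ B ∧ b < z}))
    (_ : ∀ B ∈ F, B ⊆ S ∧ ∀ b ∈ B, w b ∉ U ⊔ Submodule.span ℝ (w '' {b' | b' ∈ B ∧ b' < b}))
    (_ : ∀ t : V →ₗ[ℝ] ℝ, U ≤ LinearMap.ker t → ∑ B ∈ F, c B * ∏ z ∈ Q B, t (w z) = 0),
    ∀ B ∈ F, c B = 0 := by
  classical
  induction S using Finset.induction_on_min with
  | empty =>
    intro U F c Q hQ hF h B hB
    have hB0 : ∀ B ∈ F, B = ∅ := fun B hB => Finset.subset_empty.1 (hF B hB).1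
    have hQ0 : ∀ B ∈ F, Q B = ∅ := fun B hB => by
      ext z; simp [hQ B hB z]
    have h1 := h 0 (by simp)
    have hF1 : F = {∅} := by
      ext D; constructor
      · intro hD; simp [hB0 D hD]
      · intro hD
        rw [Finset.mem_singleton] at hD
        rw [hD, ← hB0 B hB]; exact hB
    have hE : (∅ : Finset α) ∈ F := by simp [hF1]
    rw [hF1, Finset.sum_singleton, hQ0 ∅ hE] at h1
    rw [hB0 B hB]; simpa using h1
  | insert x S hx ih =>
    intro U F c Q hQ hF h
    have hxS : x ∉ S := fun hh => lt_irrefl _ (hx x hh)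
    by_cases hU : w x ∈ U
    · have hxB : ∀ B ∈ F, x ∉ B := fun B hB hxB =>
        (hF B hB).2 x hxB (Submodule.mem_sup_left hU)
      refine ih U F c Q ?_ ?_ h
      · intro B hB z
        rw [hQ B hB z, Finset.mem_insert]
        constructor
        · rintro ⟨rfl | hz, h2, h3⟩
          · exact absurd (Submodule.mem_sup_left hU) h3
          · exact ⟨hz, h2, h3⟩
        · rintro ⟨hz, h2⟩
          exact ⟨Or.inr hz, h2⟩
      · intro B hB
        refine ⟨fun z hz => ?_, (hF B hB).2⟩
        rcases Finset.mem_insert.1 ((hF B hB).1 hz) with rfl | h1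
        · exact absurd hz (hxB B hB)
        · exact h1
    · -- nothing of `insert x S` precedes `x`
      have hmin : ∀ B ∈ F, U ⊔ Submodule.span ℝ (w '' {b | b ∈ B ∧ b < x}) = U := by
        intro B hB
        have : {b | b ∈ B ∧ b < x} = ∅ := by
          ext b
          simp only [Set.mem_ofPred_eq, Set.mem_empty_iff_false, iff_false, not_and]
          intro hb hlt
          rcases Finset.mem_insert.1 ((hF B hB).1 hb) with rfl | h1
          · exact lt_irrefl _ hlt
          · exact lt_asymm hlt (hx b h1)
        simp [this]
      have hxQ : ∀ B ∈ F, x ∉ B → x ∈ Q B := by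
        intro B hB hxB
        rw [hQ B hB, hmin B hB]
        exact ⟨Finset.mem_insert_self _ _, hxB, hU⟩
      have hspan : ∀ B : Finset α, x ∈ B → ∀ z, x < z →
          (U ⊔ Submodule.span ℝ {w x}) ⊔ Submodule.span ℝ (w '' {b | b ∈ B.erase x ∧ b < z})
            = U ⊔ Submodule.span ℝ (w '' {b | b ∈ B ∧ b < z}) := by
        intro B hxB z hz
        rw [sup_assoc, ← Submodule.span_union, ← Set.image_singleton, ← Set.image_union]
        congr 3
        ext b
        simp only [Set.mem_union, Set.mem_singleton_iff, Set.mem_ofPred_eq, Finset.mem_erase]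
        constructor
        · rintro (rfl | ⟨⟨_, h1⟩, h2⟩)
          · exact ⟨hxB, hz⟩
          · exact ⟨h1, h2⟩
        · rintro ⟨h1, h2⟩
          by_cases hb : b = x
          · exact Or.inl hb
          · exact Or.inr ⟨⟨hb, h1⟩, h2⟩
      have step1 : ∀ B ∈ F, x ∈ B → c B = 0 := by
        have := ih (U ⊔ Submodule.span ℝ {w x}) ((F.filter (x ∈ ·)).image (fun B => B.erase x))
          (fun B => c (insert x B)) (fun B => Q (insert x B)) ?_ ?_ ?_
        · intro B hB hxB
          have h2 := this (B.erase x)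
            (Finset.mem_image.2 ⟨B, Finset.mem_filter.2 ⟨hB, hxB⟩, rfl⟩)
          simpa [Finset.insert_erase hxB] using h2
        · intro B' hB' z
          obtain ⟨B, hB, rfl⟩ := Finset.mem_image.1 hB'
          obtain ⟨hB, hxB⟩ := Finset.mem_filter.1 hB
          simp only [Finset.insert_erase hxB]
          rw [hQ B hB z, Finset.mem_insert]
          constructor
          · rintro ⟨rfl | hz, h2, h3⟩
            · exact absurd hxB h2
            · refine ⟨hz, fun hh => h2 (Finset.mem_of_mem_erase hh), ?_⟩
              rwa [hspan B hxB z (hx z hz)]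
          · rintro ⟨hz, h2, h3⟩
            rw [hspan B hxB z (hx z hz)] at h3
            refine ⟨Or.inr hz, fun hh => h2 (Finset.mem_erase.2 ⟨?_, hh⟩), h3⟩
            rintro rfl; exact hxS hz
        · intro B' hB'
          obtain ⟨B, hB, rfl⟩ := Finset.mem_image.1 hB'
          obtain ⟨hB, hxB⟩ := Finset.mem_filter.1 hB
          have hsub : B.erase x ⊆ S := by
            intro z hz
            obtain ⟨h1, h2⟩ := Finset.mem_erase.1 hz
            exact (Finset.mem_insert.1 ((hF B hB).1 h2)).resolve_left h1
          refine ⟨hsub, fun b hb => ?_⟩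
          rw [hspan B hxB b (hx b (hsub hb))]
          exact (hF B hB).2 b (Finset.mem_of_mem_erase hb)
        · intro t ht
          have htx : t (w x) = 0 :=
            ht (Submodule.mem_sup_right (Submodule.mem_span_singleton_self _))
          have h1 := h t (le_trans le_sup_left ht)
          rw [Finset.sum_image]
          · rw [← h1, Finset.sum_filter]
            refine Finset.sum_congr rfl fun B hB => ?_
            split_ifs with hxB
            · rw [Finset.insert_erase hxB]
            · rw [Finset.prod_eq_zero (hxQ B hB hxB) htx, mul_zero]
          · intro B hB D hD hBD
            have hB := (Finset.mem_filter.1 (Finset.mem_coe.1 hB)).2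
            have hD := (Finset.mem_filter.1 (Finset.mem_coe.1 hD)).2
            rw [← Finset.insert_erase hB, ← Finset.insert_erase hD]
            exact congrArg _ hBD
      have step2 : ∀ B ∈ F.filter (x ∉ ·), c B = 0 := by
        refine ih U (F.filter (x ∉ ·)) c (fun B => (Q B).erase x) ?_ ?_ ?_
        · intro B hB z
          obtain ⟨hB, hxB⟩ := Finset.mem_filter.1 hB
          rw [Finset.mem_erase, hQ B hB z, Finset.mem_insert]
          constructor
          · rintro ⟨h0, h1, h2⟩
            exact ⟨h1.resolve_left h0, h2⟩
          · rintro ⟨h1, h2⟩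
            refine ⟨?_, Or.inr h1, h2⟩
            rintro rfl; exact hxS h1
        · intro B hB
          obtain ⟨hB, hxB⟩ := Finset.mem_filter.1 hB
          refine ⟨fun z hz => ?_, (hF B hB).2⟩
          refine (Finset.mem_insert.1 ((hF B hB).1 hz)).resolve_left ?_
          rintro rfl; exact hxB hz
        · have hmul : ∀ t : V →ₗ[ℝ] ℝ, U ≤ LinearMap.ker t → t (w x) *
              ∑ B ∈ F.filter (x ∉ ·), c B * ∏ z ∈ (Q B).erase x, t (w z) = 0 := by
            intro t ht
            rw [← h t ht, Finset.mul_sum, Finset.sum_filter]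
            refine Finset.sum_congr rfl fun B hB => ?_
            split_ifs with hxB
            · rw [step1 B hB hxB, zero_mul]
            · rw [← Finset.mul_prod_erase _ _ (hxQ B hB hxB)]; ring
          obtain ⟨s, hs, hsU⟩ := Submodule.exists_le_ker_of_notMem hU
          intro t ht
          by_contra hne
          set f : ℝ → ℝ := fun e =>
            ∑ B ∈ F.filter (x ∉ ·), c B * ∏ z ∈ (Q B).erase x, (t (w z) + e * s (w z)) with hf
          have hcont : Continuous f := by
            rw [hf]
            fun_prop
          have hf0 : f 0 ≠ 0 := by simpa [hf] using hne
          have hev : ∀ᶠ e in nhds (0 : ℝ), f e ≠ 0 := hcont.continuousAt.eventually_ne hf0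
          have hz : ∀ e : ℝ, (t (w x) + e * s (w x)) * f e = 0 := by
            intro e
            have := hmul (t + e • s) (fun u hu => by
              have h1 : t u = 0 := ht hu
              have h2 : s u = 0 := hsU hu
              simp [h1, h2])
            simpa [hf] using this
          have hev2 : ∀ᶠ e in nhds (0 : ℝ), t (w x) + e * s (w x) = 0 := by
            filter_upwards [hev] with e he
            exact (mul_eq_zero.1 (hz e)).resolve_right he
          obtain ⟨δ, hδ, hball⟩ := Metric.eventually_nhds_iff.1 hev2
          have e0 := hball (y := 0) (by simpa using hδ)
          have e1 := hball (y := δ / 2) (by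
            rw [Real.dist_eq, sub_zero, abs_of_pos (by positivity)]; linarith)
          have : δ / 2 * s (w x) = 0 := by linarith
          rcases mul_eq_zero.1 this with h3 | h3
          · linarith
          · exact hs h3
      intro B hB
      by_cases hxB : x ∈ B
      · exact step1 B hB hxB
      · exact step2 B (Finset.mem_filter.2 ⟨hB, hxB⟩)

lemma s7_eval (n : ℕ) (t : (Fin n → ℝ) →ₗ[ℝ] ℝ) (x : Fin n → ℝ) :
    MvPolynomial.eval (fun i => t (Pi.single i 1)) (pLin n x) = t x := by
  conv_rhs => rw [pi_eq_sum_univ' x]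
  simp [pLin, map_sum]

lemma s7_deg (n : ℕ) (x : Fin n → ℝ) : (pLin n x).totalDegree ≤ 1 := by
  unfold pLin
  refine MvPolynomial.totalDegree_finsetSum_le fun i _ => ?_
  refine (MvPolynomial.totalDegree_mul _ _).trans ?_
  simp

lemma s7_degProd (n : ℕ) {ι : Type} (v : ι → Fin n → ℝ) (Z : Finset ι) :
    (pProd n v Z).totalDegree ≤ Z.card := by
  unfold pProd
  refine (MvPolynomial.totalDegree_finsetProd _ _).trans ?_
  refine (Finset.sum_le_card_nsmul Z _ 1 fun a _ => s7_deg n _).trans ?_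
  simp

lemma s7_mem (n : ℕ) (ι : Type) [Fintype ι] [DecidableEq ι]
    (v : ι → Fin n → ℝ) (M : ℕ) (y : Fin M → Fin n → ℝ)
    (k : Finset ι → ℕ) (hsolid : Solid n v k)
    [LinearOrder ι] (B : Finset (ι ⊕ Fin M)) (hB : B ∈ Bk n v y k) :
    pProd n (Sum.elim v y) (XprimeB n v y B) ∈ Pspace n v k := by
  classical
  obtain ⟨⟨hli, htop⟩, hm⟩ := hB
  set W := XprimeB n v y B with hW
  have hmemW : ∀ z, z ∈ W ↔ z ∉ B ∧ Sum.elim v y z ∉ Submodule.span ℝ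
      (Sum.elim v y '' {b | b ∈ B ∧ Sum.Lex (· < ·) (· < ·) b z}) := by
    intro z; simp [hW, XprimeB]
  have hsplit : W = (leftPart W).disjSum (rightPart W) := by
    ext z; rcases z with z | z <;> simp [leftPart, rightPart]
  have hsplitB : B = (leftPart B).disjSum (rightPart B) := by
    ext z; rcases z with z | z <;> simp [leftPart, rightPart]
  have hprod : pProd n (Sum.elim v y) W = pProd n v (leftPart W) * pProd n y (rightPart W) := by
    conv_lhs => rw [hsplit]
    simp [pProd, Finset.prod_disjSum]
  have hcardB : B.card = n := by
    have h1 := finrank_span_eq_card hli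
    rw [show Set.range (fun b : B => Sum.elim v y b) = Sum.elim v y '' ↑B by
      ext; simp, htop] at h1
    simpa using h1.symm
  have hcard : (leftPart B).card + (rightPart B).card = n := by
    rw [← hcardB]; conv_rhs => rw [hsplitB]
    simp
  -- degree bound
  have hdeg : (rightPart W).card ≤ k (leftPart B) := by
    have hdisj : Disjoint (rightPart W) (rightPart B) := by
      rw [Finset.disjoint_left]
      intro j h1 h2
      simp only [rightPart, Finset.mem_filter, Finset.mem_univ, true_and] at h1 h2
      exact ((hmemW _).1 h1).1 h2
    have hsub : rightPart W ∪ rightPart B ⊆ YFin (mVal n k (leftPart B)) := by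
      intro j hj
      simp only [YFin, Finset.mem_filter, Finset.mem_univ, true_and]
      rcases Finset.mem_union.1 hj with h1 | h1
      · simp only [rightPart, Finset.mem_filter, Finset.mem_univ, true_and] at h1
        by_contra hlt
        refine ((hmemW _).1 h1).2 ?_
        have : {b | b ∈ B ∧ Sum.Lex (· < ·) (· < ·) b (Sum.inr j)} = (B : Set (ι ⊕ Fin M)) := by
          ext b
          simp only [Set.mem_ofPred_eq, Finset.mem_coe, and_iff_left_iff_imp]
          intro hb
          rcases b with b | b
          · exact Sum.Lex.sep _ _
          · refine Sum.Lex.inr ?_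
            have := hm b hb
            rw [Fin.lt_def]; omega
        rw [this, htop]; trivial
      · simp only [rightPart, Finset.mem_filter, Finset.mem_univ, true_and] at h1
        exact hm j h1
    have h1 := Finset.card_le_card hsub
    rw [Finset.card_union_of_disjoint hdisj] at h1
    have h2 : (YFin (M := M) (mVal n k (leftPart B))).card ≤ mVal n k (leftPart B) := by
      have : ((YFin (M := M) (mVal n k (leftPart B))).image (fun j : Fin M => (j : ℕ))) ⊆
          Finset.range (mVal n k (leftPart B)) := by
        intro a ha
        obtain ⟨j, hj, rfl⟩ := Finset.mem_image.1 ha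
        simpa [YFin] using hj
      have := Finset.card_le_card this
      rwa [Finset.card_image_of_injective _ Fin.val_injective, Finset.card_range] at this
    unfold mVal at h1 h2
    omega
  set Z : Finset ι := Finset.univ \ leftPart W with hZ
  have hkZ : k (leftPart B) ≤ k Z := by
    apply hsolid
    apply Submodule.span_mono
    apply Set.image_mono
    intro i hi
    simp only [leftPart, Finset.coe_filter, Finset.mem_univ, true_and, Set.mem_ofPred_eq] at hi
    simp only [hZ, leftPart, Finset.coe_sdiff, Set.mem_sdiff, Finset.mem_coe, Finset.mem_univ,
      Finset.mem_filter, true_and]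
    intro h1
    exact ((hmemW _).1 h1).1 hi
  rw [hprod]
  unfold Pspace
  refine Submodule.mem_iSup_of_mem Z ?_
  refine Submodule.mem_map.2 ⟨pProd n y (rightPart W), ?_, ?_⟩
  · rw [MvPolynomial.mem_restrictTotalDegree]
    exact (s7_degProd n y _).trans (hdeg.trans hkZ)
  · rw [LinearMap.mulLeft_apply, hZ, Finset.sdiff_sdiff_eq_self (Finset.subset_univ _)]

/-- for a solid assignment, the homogeneous polynomials `p_{X'(B)}`,
`B ∈ 𝔹_k`, lie in `𝒫_k` and are linearly independent. -/
theorem statement7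
    (n : ℕ) (hn : 1 ≤ n) (ι : Type) [Fintype ι] [DecidableEq ι]
    (v : ι → Fin n → ℝ) (M : ℕ) (y : Fin M → Fin n → ℝ)
    (hspan : Submodule.span ℝ (Set.range (Sum.elim v y)) = ⊤)
    (hgen : GeneralPosition n v y)
    (k : Finset ι → ℕ) (hsolid : Solid n v k)
    (hM : ∀ I : Finset ι, (LinearIndependent ℝ fun i : I => v i) → mVal n k I ≤ M)
    [LinearOrder ι] :
    (∀ B ∈ Bk n v y k, pProd n (Sum.elim v y) (XprimeB n v y B) ∈ Pspace n v k) ∧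
    LinearIndependent ℝ (fun B : Bk n v y k =>
      pProd n (Sum.elim v y) (XprimeB n v y (B : Finset (ι ⊕ Fin M)))) := by
  classical
  refine ⟨fun B hB => s7_mem n ι v M y k hsolid B hB, ?_⟩
  let L : LinearOrder (ι ⊕ Fin M) :=
    LinearOrder.lift' (toLex : ι ⊕ Fin M → Lex (ι ⊕ Fin M)) toLex.injective
  have hlt : ∀ a b : ι ⊕ Fin M, @LT.lt _ L.toLT a b ↔ Sum.Lex (· < ·) (· < ·) a b := fun a b =>
    Sum.Lex.toLex_lt_toLex
  rw [linearIndependent_iff']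
  intro s g hg
  set c : Finset (ι ⊕ Fin M) → ℝ := fun B => if h : B ∈ Bk n v y k then g ⟨B, h⟩ else 0 with hc
  have hmemBk : ∀ B ∈ s.image Subtype.val, B ∈ Bk n v y k := by
    intro B hB
    obtain ⟨D, _, rfl⟩ := Finset.mem_image.1 hB
    exact D.2
  have key := s7_key (Sum.elim v y) Finset.univ ⊥ (s.image Subtype.val) c (XprimeB n v y)
    ?_ ?_ ?_
  · intro B hB
    have := key B.1 (Finset.mem_image_of_mem _ hB)
    simpa [hc, B.2] using this
  · intro B hB z
    simp [XprimeB, hlt]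
  · intro B hB
    obtain ⟨⟨hli, _⟩, _⟩ := hmemBk B hB
    refine ⟨Finset.subset_univ _, fun b hb hmem => ?_⟩
    rw [bot_sup_eq] at hmem
    have h1 := hli.notMem_span_image (s := {b' : B | @LT.lt _ L.toLT b'.1 b}) (x := ⟨b, hb⟩)
      (by simp)
    apply h1
    refine Submodule.span_mono ?_ hmem
    rintro _ ⟨b', ⟨hb', hl⟩, rfl⟩
    exact ⟨⟨b', hb'⟩, hl, rfl⟩
  · intro t _
    have h1 := congrArg (MvPolynomial.eval (fun i => t (Pi.single i 1))) hg
    rw [Finset.sum_image Subtype.val_injective.injOn]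
    rw [map_sum, map_zero] at h1
    rw [← h1]
    refine Finset.sum_congr rfl fun B _ => ?_
    have hcB : c B.1 = g B := by simp [hc, B.2]
    rw [hcB, MvPolynomial.smul_eval, pProd, map_prod]
    simp only [s7_eval]
end

section
/- Let k be a solid assignment and assume the constants (λ_z)_{z∈X∪Y} are generic. Then 𝒫_k contains a Lagrange basis for V_k: for every B ∈ 𝔹_k there exists a polynomial L_B ∈ 𝒫_k such that L_B(b(B)) ≠ 0 and L_B(b(B′)) = 0 for every B′ ∈ 𝔹_k with B′ ≠ B. -/
open MvPolynomial

theorem aux_mono (n : ℕ) {ι : Type} (v : ι → Fin n → ℝ) (k : Finset ι → ℕ)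
    (hsolid : Solid n v k) {Z Z' : Finset ι} (h : Z ⊆ Z') : k Z ≤ k Z' :=
  hsolid Z Z' (Submodule.span_mono (Set.image_mono (by exact_mod_cast h)))

theorem aux_mem (n : ℕ) {ι : Type} [Fintype ι] [DecidableEq ι]
    (v : ι → Fin n → ℝ) (k : Finset ι → ℕ) (hsolid : Solid n v k) (lam : ι → ℝ)
    (W : Finset ι) : ∀ (U : Finset ι) (f : MvPolynomial (Fin n) ℝ),
      Disjoint U W → f.totalDegree ≤ k (Finset.univ \ (U ∪ W)) →
      pProd n v U * (qProd n v lam W * f) ∈ Pspace n v k := by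
  induction W using Finset.induction_on with
  | empty =>
    intro U f _ hf
    refine Submodule.mem_iSup_of_mem (Finset.univ \ U) ?_
    refine ⟨f, ?_, ?_⟩
    · rw [SetLike.mem_coe, MvPolynomial.mem_restrictTotalDegree]
      simpa using hf
    · simp [qProd]
  | insert a W ha ih =>
    intro U f hU hf
    rw [Finset.disjoint_insert_right] at hU
    have h1 := ih (insert a U) f (by
      rw [Finset.disjoint_insert_left]; exact ⟨ha, hU.2⟩) (by
      rw [Finset.insert_union, ← Finset.union_insert]; exact hf)
    have h2 := ih U f hU.2 (hf.trans (aux_mono n v k hsolid (by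
      apply Finset.sdiff_subset_sdiff le_rfl
      apply Finset.union_subset_union le_rfl (Finset.subset_insert _ _))))
    have h3 := Submodule.sub_mem _ h1 (Submodule.smul_mem _ (lam a) h2)
    convert h3 using 1
    simp only [qProd, pProd, Finset.prod_insert ha, Finset.prod_insert hU.1,
      MvPolynomial.smul_eq_C_mul]
    ring

theorem aux_deg (n : ℕ) {ι : Type} (v : ι → Fin n → ℝ) (lam : ι → ℝ) (W : Finset ι) :
    (qProd n v lam W).totalDegree ≤ W.card := by
  unfold qProd
  refine (MvPolynomial.totalDegree_finset_prod _ _).trans ?_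
  refine (Finset.sum_le_card_nsmul _ _ 1 ?_).trans (by simp)
  intro a _
  refine (MvPolynomial.totalDegree_sub _ _).trans ?_
  rw [MvPolynomial.totalDegree_C]
  refine max_le ?_ (Nat.zero_le _)
  unfold pLin
  refine MvPolynomial.totalDegree_finsetSum_le ?_
  intro i _
  refine (MvPolynomial.totalDegree_mul _ _).trans ?_
  simp

theorem aux_card (n : ℕ) {ι : Type} (v : ι → Fin n → ℝ) (B : Finset ι)
    (h : IsBasisSet n v B) : B.card = n := by
  have h1 := Module.finrank_eq_card_basis (Module.Basis.mk h.1 (by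
    rw [← h.2]
    apply Submodule.span_mono
    rintro _ ⟨x, hx, rfl⟩
    exact ⟨⟨x, hx⟩, rfl⟩))
  simpa using h1.symm

theorem aux_parts {ι : Type} [Fintype ι] [DecidableEq ι] {M : ℕ} (B : Finset (ι ⊕ Fin M)) :
    (leftPart B).card + (rightPart B).card = B.card := by
  have : B = (leftPart B).disjSum (rightPart B) := by
    ext z
    cases z <;> simp [leftPart, rightPart]
  conv_rhs => rw [this]
  rw [Finset.card_disjSum]

theorem aux_eval (n : ℕ) {ι : Type} (v : ι → Fin n → ℝ) (lam : ι → ℝ) (W : Finset ι)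
    (t : Fin n → ℝ) : MvPolynomial.eval t (qProd n v lam W) = 0 ↔
      ∃ a ∈ W, MvPolynomial.eval t (pLin n (v a) - MvPolynomial.C (lam a)) = 0 := by
  unfold qProd
  rw [map_prod, Finset.prod_eq_zero_iff]

theorem aux_tri
    (n : ℕ) (ι : Type) [Fintype ι] [DecidableEq ι]
    (v : ι → Fin n → ℝ) (M : ℕ) (y : Fin M → Fin n → ℝ)
    (k : Finset ι → ℕ) (hsolid : Solid n v k)
    (lam : ι ⊕ Fin M → ℝ) (bp : Finset (ι ⊕ Fin M) → Fin n → ℝ)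
    (hgeneric : Generic n (Sum.elim v y) lam bp) :
    ∀ B ∈ Bk n v y k, ∃ L ∈ Pspace n v k,
      MvPolynomial.eval (bp B) L ≠ 0 ∧
      ∀ B' ∈ Bk n v y k, B' ≠ B → MvPolynomial.eval (bp B') L ≠ 0 →
        (leftPart B').card < (leftPart B).card := by
  intro B hB
  have hc := aux_parts B
  rw [aux_card n _ B hB.1] at hc
  refine ⟨qProd n v (lam ∘ Sum.inl) (Finset.univ \ leftPart B) *
    qProd n y (lam ∘ Sum.inr) (YFin (mVal n k (leftPart B)) \ rightPart B), ?_, ?_, ?_⟩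
  · have h := aux_mem n v k hsolid (lam ∘ Sum.inl) (Finset.univ \ leftPart B) ∅
      (qProd n y (lam ∘ Sum.inr) (YFin (mVal n k (leftPart B)) \ rightPart B)) (by simp) (by
        refine (aux_deg _ _ _ _).trans ?_
        have hsub : rightPart B ⊆ YFin (mVal n k (leftPart B)) := by
          intro j hj
          simp only [rightPart, YFin, Finset.mem_filter, Finset.mem_univ, true_and] at hj ⊢
          exact hB.2 j hj
        have hY : (YFin (M := M) (mVal n k (leftPart B))).card ≤ mVal n k (leftPart B) := by
          have := Finset.card_le_card_of_injOn (s := YFin (M := M) (mVal n k (leftPart B)))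
            (t := Finset.range (mVal n k (leftPart B))) (fun j => (j : ℕ))
            (by intro j hj; simpa [YFin] using hj) (Fin.val_injective.injOn)
          simpa using this
        rw [Finset.card_sdiff_of_subset hsub]
        have : Finset.univ \ (∅ ∪ (Finset.univ \ leftPart B)) = leftPart B := by
          ext; simp
        rw [this]
        unfold mVal at *
        omega)
    simpa [pProd] using h
  · rw [map_mul]
    refine mul_ne_zero ?_ ?_
    · rw [Ne, aux_eval]
      rintro ⟨a, ha, h0⟩
      have := (hgeneric B hB.1 (Sum.inl a)).1 h0
      simp [leftPart] at ha
      exact ha this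
    · rw [Ne, aux_eval]
      rintro ⟨a, ha, h0⟩
      have := (hgeneric B hB.1 (Sum.inr a)).1 h0
      simp [rightPart] at ha
      exact ha.2 this
  · intro B' hB' hne h0
    rw [map_mul] at h0
    have h1 := left_ne_zero_of_mul h0
    have h2 := right_ne_zero_of_mul h0
    rw [Ne, aux_eval] at h1 h2
    have hl : leftPart B' ⊆ leftPart B := by
      intro i hi
      by_contra hn
      refine h1 ⟨i, by simp [hn], (hgeneric B' hB'.1 (Sum.inl i)).2 ?_⟩
      simpa [leftPart] using hi
    refine Finset.card_lt_card (Finset.ssubset_iff_subset_ne.2 ⟨hl, fun he => hne ?_⟩)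
    apply Finset.eq_of_subset_of_card_le
    · rintro (i | j) hz
      · have : i ∈ leftPart B := by rw [← he]; simpa [leftPart] using hz
        simpa [leftPart] using this
      · by_contra hn
        refine h2 ⟨j, ?_, (hgeneric B' hB'.1 (Sum.inr j)).2 hz⟩
        have := hB'.2 j hz
        rw [he] at this
        simp [YFin, rightPart, this, hn]
    · rw [aux_card n _ B hB.1, aux_card n _ B' hB'.1]

theorem aux_main
    (n : ℕ) (ι : Type) [Fintype ι] [DecidableEq ι]
    (v : ι → Fin n → ℝ) (M : ℕ) (y : Fin M → Fin n → ℝ)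
    (k : Finset ι → ℕ) (hsolid : Solid n v k)
    (lam : ι ⊕ Fin M → ℝ) (bp : Finset (ι ⊕ Fin M) → Fin n → ℝ)
    (hgeneric : Generic n (Sum.elim v y) lam bp) (N : ℕ) :
    ∀ B ∈ Bk n v y k, (leftPart B).card = N → ∃ L ∈ Pspace n v k,
      MvPolynomial.eval (bp B) L ≠ 0 ∧
      ∀ B' ∈ Bk n v y k, B' ≠ B → MvPolynomial.eval (bp B') L = 0 := by
  classical
  induction N using Nat.strong_induction_on with
  | _ N ih =>
    intro B hB hN
    obtain ⟨L, hL, hLB, hL'⟩ := aux_tri n ι v M y k hsolid lam bp hgeneric B hB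
    have key : ∀ B' : Finset (ι ⊕ Fin M), ∃ Q ∈ Pspace n v k,
        (B' ∈ Bk n v y k → (leftPart B').card < N → MvPolynomial.eval (bp B') Q = 1) ∧
        (∀ B'' ∈ Bk n v y k, B'' ≠ B' → MvPolynomial.eval (bp B'') Q = 0) := by
      intro B'
      by_cases h : B' ∈ Bk n v y k ∧ (leftPart B').card < N
      · obtain ⟨Q, hQ, h1, h2⟩ := ih _ h.2 B' h.1 rfl
        refine ⟨(MvPolynomial.eval (bp B') Q)⁻¹ • Q, Submodule.smul_mem _ _ hQ, ?_, ?_⟩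
        · intro _ _
          rw [MvPolynomial.smul_eval, inv_mul_cancel₀ h1]
        · intro B'' h3 h4
          rw [MvPolynomial.smul_eval, h2 B'' h3 h4, mul_zero]
      · refine ⟨0, Submodule.zero_mem _, fun h1 h2 => absurd ⟨h1, h2⟩ h, by simp⟩
    choose Q hQ hQ1 hQ0 using key
    refine ⟨L - ∑ A ∈ Finset.univ.erase B, MvPolynomial.eval (bp A) L • Q A, ?_, ?_, ?_⟩
    · exact Submodule.sub_mem _ hL (Submodule.sum_mem _ fun A _ => Submodule.smul_mem _ _ (hQ A))
    · rw [map_sub, map_sum, Finset.sum_eq_zero, sub_zero]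
      · exact hLB
      · intro A hA
        rw [MvPolynomial.smul_eval, hQ0 A B hB (Finset.ne_of_mem_erase hA).symm, mul_zero]
    · intro B' hB' hne
      rw [map_sub, map_sum, Finset.sum_eq_single B']
      · rw [MvPolynomial.smul_eval]
        by_cases h0 : MvPolynomial.eval (bp B') L = 0
        · simp [h0]
        · rw [hQ1 B' hB' (hN ▸ hL' B' hB' hne h0)]
          ring
      · intro A _ hA
        rw [MvPolynomial.smul_eval, hQ0 A B' hB' hA.symm, mul_zero]
      · intro h
        simp [hne] at h

/-- for a solid assignment and generic constants, `𝒫_k` contains a Lagrange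
basis for `V_k`. -/
theorem statement8
    (n : ℕ) (hn : 1 ≤ n) (ι : Type) [Fintype ι] [DecidableEq ι]
    (v : ι → Fin n → ℝ) (M : ℕ) (y : Fin M → Fin n → ℝ)
    (hspan : Submodule.span ℝ (Set.range (Sum.elim v y)) = ⊤)
    (hgen : GeneralPosition n v y)
    (k : Finset ι → ℕ) (hsolid : Solid n v k)
    (hM : ∀ I : Finset ι, (LinearIndependent ℝ fun i : I => v i) → mVal n k I ≤ M)
    (lam : ι ⊕ Fin M → ℝ) (bp : Finset (ι ⊕ Fin M) → Fin n → ℝ)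
    (hgeneric : Generic n (Sum.elim v y) lam bp) :
    ∀ B ∈ Bk n v y k, ∃ L ∈ Pspace n v k,
      MvPolynomial.eval (bp B) L ≠ 0 ∧
      ∀ B' ∈ Bk n v y k, B' ≠ B → MvPolynomial.eval (bp B') L = 0 := by
  exact fun B hB => aux_main n ι v M y k hsolid lam bp hgeneric _ B hB rfl
end

section
/- Let k be a solid assignment, let Z ⊆ X, and let f be a polynomial of degree at most k(X∖Z). Then q_Z·f ∈ 𝒫_k. -/
open MvPolynomial

/-- for a solid assignment, `Z ⊆ X` and `deg f ≤ k(X∖Z)`, one has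
`q_Z · f ∈ 𝒫_k`. -/
theorem statement9
    (n : ℕ) (hn : 1 ≤ n) (ι : Type) [Fintype ι] [DecidableEq ι]
    (v : ι → Fin n → ℝ)
    (k : Finset ι → ℕ) (hsolid : Solid n v k)
    (lam : ι → ℝ) (Z : Finset ι) (f : MvPolynomial (Fin n) ℝ)
    (hf : f.totalDegree ≤ k (Finset.univ \ Z)) :
    qProd n v lam Z * f ∈ Pspace n v k := by
  have key : ∀ W : Finset ι, W ⊆ Z → pProd n v W * f ∈ Pspace n v k := by
    intro W hW
    refine Submodule.mem_iSup_of_mem (Finset.univ \ W) ?_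
    rw [Submodule.mem_map]
    refine ⟨f, ?_, ?_⟩
    · rw [MvPolynomial.mem_restrictTotalDegree]
      refine hf.trans (hsolid _ _ (Submodule.span_mono (Set.image_mono ?_)))
      exact Finset.coe_subset.mpr (Finset.sdiff_subset_sdiff (Finset.Subset.refl _) hW)
    · simp
  unfold qProd
  simp only [sub_eq_add_neg]
  rw [Finset.prod_add, Finset.sum_mul]
  refine Submodule.sum_mem _ fun W hW => ?_
  have h := Submodule.smul_mem _ (∏ a ∈ Z \ W, -lam a) (key W (Finset.mem_powerset.mp hW))
  convert h using 1
  rw [MvPolynomial.smul_eq_C_mul, map_prod]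
  simp only [map_neg, pProd]
  ring
end
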